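/- Let Ω be a simply connected domain contained in the upper half-plane {Im w > 0}, convex in the positive direction and not contained in any horizontal strip, let h be a Koenigs map onto Ω, and fix p ≥ 1 and α > -1. If θ_Ω = Θ_Ω = π, then for every λ ∈ ℂ one has e^{λh} ∈ A_α^p if and only if λ = it for some real t ≥ 0 (i.e. Re λ = 0 and Im λ ≥ 0); that is, σ_{p,α} = {it : t ≥ 0}. (Theorem 1.5(c) for the Bergman space; in particular this computes the point spectrum for semigroups of finite shift.) -/

import Mathlib

open MeasureTheory Set Complex Metric
open scoped ENNReal NNReal

noncomputable section

/-- `h` is a Koenigs map onto `Ω`: an injective holomorphic map on the unit disk with image `Ω`. -/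
def IsKoenigsMap (h : ℂ → ℂ) (Ω : Set ℂ) : Prop :=
  DifferentiableOn ℂ h (ball 0 1) ∧ InjOn h (ball 0 1) ∧ h '' ball 0 1 = Ω

/-- `Ω` is convex in the positive direction: `Ω + t ⊆ Ω` for all `t ≥ 0`. -/
def ConvexPosDir (Ω : Set ℂ) : Prop :=
  ∀ t : ℝ, 0 ≤ t → ∀ w ∈ Ω, w + (t : ℂ) ∈ Ω

/-- Membership in the weighted Bergman space `A_α^p`:
`∫_𝔻 |f(z)|^p (1-|z|²)^α dA(z) < ∞`. -/
def MemBergman (p α : ℝ) (f : ℂ → ℂ) : Prop :=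
  ∫⁻ z in ball (0 : ℂ) 1,
    (‖f z‖₊ : ℝ≥0∞) ^ p * ENNReal.ofReal ((1 - ‖z‖ ^ 2) ^ α) < ⊤

/-- The open angular sector `S(α,β) = {w ≠ 0 : α < arg w < β}` (principal argument). -/
def sector (a b : ℝ) : Set ℂ :=
  {w : ℂ | w ≠ 0 ∧ a < Complex.arg w ∧ Complex.arg w < b}

/-- The inner argument `θ_Ω` of a domain contained in the upper half-plane. -/
def innerArg (Ω : Set ℂ) : ℝ :=
  sSup ({0} ∪ {θ : ℝ | θ ∈ Ioc 0 Real.pi ∧ ∃ q : ℂ, (fun w => q + w) '' sector 0 θ ⊆ Ω})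

/-- The outer argument `Θ_Ω` of a domain contained in the upper half-plane. -/
def outerArg (Ω : Set ℂ) : ℝ :=
  sInf {θ : ℝ | θ ∈ Ioc 0 Real.pi ∧ ∃ q : ℂ, Ω ⊆ (fun w => q + w) '' sector 0 θ}

theorem lintegral_one_sub_norm_sq_rpow_lt_top {α : ℝ} (hα : -1 < α) :
    ∫⁻ z in ball (0 : ℂ) 1, ENNReal.ofReal ((1 - ‖z‖ ^ 2) ^ α) < ⊤ := by
  have key : IntegrableOn (fun z : ℂ => (1 - ‖z‖ ^ 2) ^ α) (ball 0 1) := by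
    refine (integrableOn_fun_norm_addHaar (E := ℂ) volume (f := fun y => (1 - y ^ 2) ^ α)
      (r := 1)).2 ?_
    have h1 : IntervalIntegrable (fun y : ℝ => (1 - y) ^ α) volume 0 1 := by
      simpa using ((intervalIntegral.intervalIntegrable_rpow' (a := 0) (b := 1) hα).comp_sub_left
        1).symm
    have h2 : ContinuousOn (fun y : ℝ => y * (1 + y) ^ α) (uIcc 0 1) := by
      refine continuousOn_id.mul ((continuousOn_const.add continuousOn_id).rpow_const fun y hy => ?_)
      rw [uIcc_of_le zero_le_one] at hy
      exact Or.inl (ne_of_gt (add_pos_of_pos_of_nonneg one_pos hy.1))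
    have h3 := h1.continuousOn_mul h2
    rw [intervalIntegrable_iff_integrableOn_Ioo_of_le zero_le_one] at h3
    refine h3.congr_fun (fun y hy => ?_) measurableSet_Ioo
    have hy1 : 0 ≤ 1 - y := by linarith [hy.2]
    have hy2 : 0 ≤ 1 + y := by linarith [hy.1]
    simp only [Complex.finrank_real_complex, smul_eq_mul]
    rw [show 1 - y ^ 2 = (1 + y) * (1 - y) by ring, Real.mul_rpow hy2 hy1]
    simp [mul_assoc]
  exact key.lintegral_lt_top

theorem enorm_mul_le_lintegral_ball {F : ℂ → ℂ} {z : ℂ} {R : ℝ} (hR : 0 < R)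
    (hF : DifferentiableOn ℂ F (ball z R)) :
    ENNReal.ofReal (R / 2) * (ENNReal.ofReal (R / 2) * (ENNReal.ofReal (2 * Real.pi) * ‖F z‖ₑ))
      ≤ ∫⁻ w in ball z R, ‖F w‖ₑ := by
  classical
  have hmeas : Measurable ((ball z R).piecewise F 0) :=
    hF.continuousOn.measurable_piecewise continuousOn_const measurableSet_ball
  have hpol : Measurable fun q : ℝ × ℝ => (Complex.polarCoord.symm q : ℂ) := by
    simp only [Complex.polarCoord_symm_apply]
    fun_prop
  obtain ⟨f, hf⟩ : ∃ f : ℂ → ℂ, f = (ball z R).piecewise F 0 := ⟨_, rfl⟩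
  rw [← hf] at hmeas
  have e1 : ∫⁻ w in ball z R, ‖F w‖ₑ = ∫⁻ w, ‖f (z + w)‖ₑ := by
    rw [lintegral_add_left_eq_self (fun w => ‖f w‖ₑ) z, ← lintegral_indicator measurableSet_ball]
    congr 1
    ext w
    by_cases hw : w ∈ ball z R <;> simp [hf, hw]
  have circ : ∀ r ∈ Ioo (R / 2) R,
      ENNReal.ofReal (R / 2) * (ENNReal.ofReal (2 * Real.pi) * ‖F z‖ₑ) ≤
      ∫⁻ θ in Ioo (-Real.pi) Real.pi,
        ENNReal.ofReal r • ‖f (z + Complex.polarCoord.symm (r, θ))‖ₑ := by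
    intro r hr
    have hr0 : 0 < r := by linarith [hr.1]
    have hd : DiffContOnCl ℂ F (ball z |r|) := by
      refine (hF.mono ?_).diffContOnCl
      rw [abs_of_pos hr0]
      exact (closure_ball_subset_closedBall).trans (closedBall_subset_ball hr.2)
    have hc := hd.circleAverage
    rw [Real.circleAverage_eq_integral_add (-Real.pi),
      intervalIntegral.integral_comp_add_right (fun θ => F (circleMap z r θ)),
      inv_smul_eq_iff₀ (by positivity)] at hc
    simp only [zero_add, show 2 * Real.pi + -Real.pi = Real.pi by ring] at hc
    rw [intervalIntegral.integral_of_le (by linarith [Real.pi_pos]),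
      integral_Ioc_eq_integral_Ioo] at hc
    simp only [smul_eq_mul]
    rw [lintegral_const_mul' _ _ ENNReal.ofReal_ne_top]
    refine mul_le_mul' (ENNReal.ofReal_le_ofReal hr.1.le) ?_
    have : ENNReal.ofReal (2 * Real.pi) * ‖F z‖ₑ = ‖(2 * Real.pi) • F z‖ₑ := by
      rw [enorm_smul, Real.enorm_of_nonneg (by positivity)]
    rw [this, ← hc]
    refine (enorm_integral_le_lintegral_enorm _).trans (lintegral_mono fun θ => ?_)
    have : z + Complex.polarCoord.symm (r, θ) = circleMap z r θ := by
      simp [circleMap, Complex.polarCoord_symm_apply, Complex.exp_mul_I]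
    have hm : circleMap z r θ ∈ ball z R := by
      refine closedBall_subset_ball hr.2 (circleMap_mem_closedBall z hr0.le θ)
    rw [this, hf, piecewise_eq_of_mem _ _ _ hm]
  rw [e1, ← Complex.lintegral_comp_polarCoord_symm, polarCoord_target,
    Measure.volume_eq_prod, ← Measure.prod_restrict, lintegral_prod]
  · calc _ = ∫⁻ r in Ioo (R / 2) R,
        ENNReal.ofReal (R / 2) * (ENNReal.ofReal (2 * Real.pi) * ‖F z‖ₑ) := by
          rw [setLIntegral_const, Real.volume_Ioo, show R - R / 2 = R / 2 by ring, mul_comm]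
      _ ≤ _ := setLIntegral_mono' measurableSet_Ioo circ
      _ ≤ _ := lintegral_mono_set fun r hr => lt_trans (by positivity) hr.1
  · exact (measurable_fst.ennreal_ofReal.smul (hmeas.comp (hpol.const_add z)).enorm).aemeasurable

theorem exists_differentiableOn_inverse {U : Set ℂ} {h : ℂ → ℂ} (hU : IsOpen U)
    (hd : DifferentiableOn ℂ h U) (hi : InjOn h U) :
    ∃ g : ℂ → ℂ, DifferentiableOn ℂ g (h '' U) ∧ ∀ z ∈ U, g (h z) = z := by
  classical
  let g := Function.invFunOn h U
  have hg : ∀ z ∈ U, g (h z) = z := fun z hz => hi.leftInvOn_invFunOn hz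
  refine ⟨g, ?_, hg⟩
  have an : ∀ z ∈ U, AnalyticAt ℂ h z := fun z hz => hd.analyticAt (hU.mem_nhds hz)
  have nc : ∀ z ∈ U, ¬ ∀ᶠ w in nhds z, h w = h z := by
    intro z hz hev
    have h1 : ∀ᶠ w in nhds z, w = z := by
      filter_upwards [hev, hU.mem_nhds hz] with w hw hwU using hi hwU hz hw
    have h2 : ∀ᶠ w in nhdsWithin z {z}ᶜ, False := by
      filter_upwards [nhdsWithin_le_nhds h1, self_mem_nhdsWithin] with w hw hw' using hw' hw
    exact h2.exists.elim fun _ h => h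
  have op : ∀ z ∈ U, nhds (h z) ≤ Filter.map h (nhds z) := fun z hz =>
    (an z hz).eventually_constant_or_nhds_le_map_nhds.resolve_left (nc z hz)
  have img : ∀ z ∈ U, ∀ V ∈ nhds z, h '' (V ∩ U) ∈ nhds (h z) := fun z hz V hV =>
    op z hz (Filter.image_mem_map (Filter.inter_mem hV (hU.mem_nhds hz)))
  have cont : ∀ z ∈ U, ContinuousAt g (h z) := by
    intro z hz V hV
    rw [hg z hz] at hV
    refine Filter.mem_map.2 (Filter.mem_of_superset (img z hz V hV) ?_)
    rintro _ ⟨w, hw, rfl⟩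
    simpa [hg w hw.2] using hw.1
  rintro _ ⟨z, hz, rfl⟩
  refine (analyticAt_of_differentiable_on_punctured_nhds_of_continuousAt ?_
    (cont z hz)).differentiableAt.differentiableWithinAt
  rcases (an z hz).deriv.eventually_eq_zero_or_eventually_ne_zero with h0 | h0
  · exfalso
    obtain ⟨ε, hε, hb⟩ := Metric.eventually_nhds_iff_ball.1 (h0.and (hU.mem_nhds hz))
    refine nc z hz ?_
    filter_upwards [ball_mem_nhds z hε] with w hw
    exact isOpen_ball.is_const_of_deriv_eq_zero (convex_ball z ε).isPreconnected
      (hd.mono fun x hx => (hb x hx).2) (fun x hx => (hb x hx).1) hw (mem_ball_self hε)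
  · rw [eventually_nhdsWithin_iff] at h0 ⊢
    filter_upwards [img z hz _ h0] with w hw hne
    obtain ⟨x, ⟨hx, hxU⟩, rfl⟩ := hw
    have hxz : x ≠ z := fun h => hne (by simp [h])
    refine (HasDerivAt.of_local_left_inverse (f := h) (f' := deriv h x) (cont x hxU) ?_
      (hx hxz) ?_).differentiableAt
    · rw [hg x hxU]
      exact (an x hxU).differentiableAt.hasDerivAt
    · filter_upwards [img x hxU _ Filter.univ_mem] with y hy
      obtain ⟨t, ht, rfl⟩ := hy
      rw [hg t ht.2]

theorem one_sub_norm_sq_le_of_mapsTo_ball {g : ℂ → ℂ} {a w : ℂ} {R : ℝ}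
    (hg : DifferentiableOn ℂ g (ball a R)) (hm : MapsTo g (ball a R) (ball 0 1))
    (hw : w ∈ ball a R) (hwR : dist w a ≤ R / 2) :
    (1 - ‖g a‖ ^ 2) * (3 / 16) ≤ 1 - ‖g w‖ ^ 2 := by
  have hR : 0 < R := pos_of_mem_ball hw
  have lt1 : ∀ x ∈ ball a R, ‖g x‖ < 1 := fun x hx => by simpa using hm hx
  have ha := lt1 a (mem_ball_self hR)
  set c := g a with hc
  have lower : ∀ x ∈ ball a R, 1 - ‖c‖ ≤ ‖1 - (starRingEnd ℂ) c * g x‖ := by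
    intro x hx
    have h1 := norm_sub_norm_le (1 : ℂ) ((starRingEnd ℂ) c * g x)
    have h2 : ‖(starRingEnd ℂ) c * g x‖ ≤ ‖c‖ := by
      rw [norm_mul, RCLike.norm_conj]
      exact mul_le_of_le_one_right (norm_nonneg _) (lt1 x hx).le
    rw [norm_one] at h1
    linarith
  have ident : ∀ x : ℂ, ‖1 - (starRingEnd ℂ) c * x‖ ^ 2 - ‖x - c‖ ^ 2 =
      (1 - ‖c‖ ^ 2) * (1 - ‖x‖ ^ 2) := by
    intro x
    simp only [← Complex.normSq_eq_norm_sq, Complex.normSq_apply]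
    simp
    ring
  have ne0 : ∀ x ∈ ball a R, 1 - (starRingEnd ℂ) c * g x ≠ 0 := fun x hx =>
    norm_pos_iff.1 (by linarith [lower x hx])
  let φ : ℂ → ℂ := fun x => (g x - c) / (1 - (starRingEnd ℂ) c * g x)
  have hφ : DifferentiableOn ℂ φ (ball a R) :=
    (hg.sub_const c).div ((differentiableOn_const _).sub ((differentiableOn_const _).mul hg)) ne0
  have hφa : φ a = 0 := by simp [φ, ← hc]
  have hφm : MapsTo φ (ball a R) (closedBall (φ a) 1) := by
    intro x hx
    rw [hφa, mem_closedBall_zero_iff, norm_div]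
    refine div_le_one_of_le₀ ?_ (norm_nonneg _)
    have h1 := ident (g x)
    have h2 : 0 ≤ (1 - ‖c‖ ^ 2) * (1 - ‖g x‖ ^ 2) := by
      have := lt1 x hx
      exact mul_nonneg (by nlinarith [norm_nonneg c]) (by nlinarith [norm_nonneg (g x)])
    exact (sq_le_sq₀ (norm_nonneg _) (norm_nonneg _)).1 (by linarith)
  have hs : ‖φ w‖ ≤ 1 / 2 := by
    have h1 := dist_le_div_mul_dist_of_mapsTo_ball hφ hφm hw
    rw [hφa, dist_zero_right] at h1
    refine h1.trans ?_
    calc 1 / R * dist w a ≤ 1 / R * (R / 2) := by gcongr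
      _ = 1 / 2 := by field_simp
  have hnum : ‖g w - c‖ ≤ 1 / 2 * ‖1 - (starRingEnd ℂ) c * g w‖ := by
    rw [norm_div] at hs
    exact (div_le_iff₀ (norm_pos_iff.2 (ne0 w hw))).1 hs
  have h1 := ident (g w)
  have h2 := lower w hw
  have h3 : (1 - ‖c‖) ^ 2 ≤ ‖1 - (starRingEnd ℂ) c * g w‖ ^ 2 :=
    pow_le_pow_left₀ (by linarith) h2 2
  have h4 : ‖g w - c‖ ^ 2 ≤ (1 / 2 * ‖1 - (starRingEnd ℂ) c * g w‖) ^ 2 :=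
    pow_le_pow_left₀ (norm_nonneg _) hnum 2
  have h5 : 3 / 4 * (1 - ‖c‖) ^ 2 ≤ (1 - ‖c‖ ^ 2) * (1 - ‖g w‖ ^ 2) := by nlinarith
  have hc0 := norm_nonneg c
  have h6 : 3 / 4 * (1 - ‖c‖) ≤ (1 + ‖c‖) * (1 - ‖g w‖ ^ 2) := by
    have : 0 < 1 - ‖c‖ := by linarith
    refine le_of_mul_le_mul_left ?_ this
    linarith
  have h7 : 0 ≤ 1 - ‖g w‖ ^ 2 := by nlinarith [norm_nonneg (g w), lt1 w hw]
  nlinarith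

theorem exists_norm_mul_pow_le_of_lintegral_lt_top {F : ℂ → ℂ} {α : ℝ}
    (hF : DifferentiableOn ℂ F (ball 0 1))
    (hI : ∫⁻ z in ball (0 : ℂ) 1, ‖F z‖ₑ * ENNReal.ofReal ((1 - ‖z‖ ^ 2) ^ α) < ⊤) :
    ∃ (C : ℝ) (N : ℕ), ∀ z ∈ ball (0 : ℂ) 1, ‖F z‖ * (1 - ‖z‖ ^ 2) ^ N ≤ C := by
  obtain ⟨M, hM⟩ := exists_nat_ge α
  set I := ∫⁻ z in ball (0 : ℂ) 1, ‖F z‖ₑ * ENNReal.ofReal ((1 - ‖z‖ ^ 2) ^ α) with hIdef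
  refine ⟨I.toReal * (64 * 2 ^ M / (2 * Real.pi)), M + 2, fun z hz => ?_⟩
  have hz1 : ‖z‖ < 1 := by simpa using hz
  set d := 1 - ‖z‖ ^ 2 with hd
  have hd0 : 0 < d := by nlinarith [norm_nonneg z]
  have near : ∀ w ∈ ball z (d / 4), ‖w‖ < 1 ∧ d / 2 ≤ 1 - ‖w‖ ^ 2 := by
    intro w hw
    have h1 : ‖w‖ - ‖z‖ < d / 4 := (norm_sub_norm_le w z).trans_lt (by simpa [dist_eq_norm] using hw)
    have h2 : ‖w‖ < 1 := by nlinarith [norm_nonneg z]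
    exact ⟨h2, by nlinarith [norm_nonneg z, norm_nonneg w]⟩
  have hsub : ball z (d / 4) ⊆ ball 0 1 := fun w hw => by simpa using (near w hw).1
  have h1 := enorm_mul_le_lintegral_ball (by positivity : 0 < d / 4) (hF.mono hsub)
  have h2 : (∫⁻ w in ball z (d / 4), ‖F w‖ₑ) * ENNReal.ofReal ((d / 2) ^ M) ≤ I := by
    rw [← lintegral_mul_const' _ _ ENNReal.ofReal_ne_top]
    refine (setLIntegral_mono' measurableSet_ball fun w hw => ?_).trans (lintegral_mono_set hsub)
    obtain ⟨-, hw2⟩ := near w hw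
    refine mul_le_mul_right (ENNReal.ofReal_le_ofReal ?_) _
    have hpos : 0 < 1 - ‖w‖ ^ 2 := by linarith
    calc (d / 2) ^ M ≤ (1 - ‖w‖ ^ 2) ^ M := pow_le_pow_left₀ (by positivity) hw2 M
      _ = (1 - ‖w‖ ^ 2) ^ (M : ℝ) := (Real.rpow_natCast _ _).symm
      _ ≤ _ := Real.rpow_le_rpow_of_exponent_ge hpos (by nlinarith [norm_nonneg w]) hM
  have h3 := (mul_le_mul_left h1 (ENNReal.ofReal ((d / 2) ^ M))).trans h2
  have h4 := ENNReal.toReal_mono hI.ne h3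
  simp only [ENNReal.toReal_mul, toReal_enorm] at h4
  rw [ENNReal.toReal_ofReal (by positivity), ENNReal.toReal_ofReal (by positivity),
    ENNReal.toReal_ofReal (by positivity)] at h4
  calc ‖F z‖ * d ^ (M + 2)
      = (d / 4 / 2 * (d / 4 / 2 * (2 * Real.pi * ‖F z‖)) * (d / 2) ^ M) *
        (64 * 2 ^ M / (2 * Real.pi)) := by
          rw [div_pow]
          field_simp
          ring
    _ ≤ _ := by gcongr

theorem isOpen_sector {a b : ℝ} (hb : b ≤ Real.pi) : IsOpen (sector a b) := by
  rw [isOpen_iff_mem_nhds]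
  rintro w ⟨hw0, hwa, hwb⟩
  have hc : ContinuousAt arg w :=
    continuousAt_arg (mem_slitPlane_iff_arg.2 ⟨(hwb.trans_le hb).ne, hw0⟩)
  filter_upwards [isOpen_ne.mem_nhds hw0, hc.eventually_const_lt hwa, hc.eventually_lt_const hwb]
    with x h0 h1 h2 using ⟨h0, h1, h2⟩

theorem real_mul_mem_sector {a b r : ℝ} (hr : 0 < r) {w : ℂ} (hw : w ∈ sector a b) :
    (r : ℂ) * w ∈ sector a b := by
  refine ⟨mul_ne_zero (by exact_mod_cast hr.ne') hw.1, ?_⟩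
  rw [arg_real_mul w hr]
  exact hw.2

theorem exists_linear_lt_exponential (a L : ℝ) {B ρ : ℝ} (hB : 0 < B) (hρ : 1 < ρ) :
    ∃ n : ℕ, n * L < a + B * ρ ^ n := by
  by_contra! hcon
  have ht : Filter.Tendsto (fun n : ℕ => (n : ℝ) ^ 1 / ρ ^ n * L - a * (ρ ^ n)⁻¹) Filter.atTop
      (nhds (0 * L - a * 0)) :=
    ((tendsto_pow_const_div_const_pow_of_one_lt 1 hρ).mul_const L).sub
      ((tendsto_pow_atTop_atTop_of_one_lt hρ).inv_tendsto_atTop.const_mul a)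
  have hle := ge_of_tendsto' ht fun n => show B ≤ _ by
    have hpos : 0 < ρ ^ n := by positivity
    have h1 := hcon n
    rw [pow_one, div_mul_eq_mul_div, ← div_eq_mul_inv, ← sub_div, le_div_iff₀ hpos]
    linarith
  linarith

theorem exists_mem_upperHalfPlane_re_mul_pos {lam : ℂ} (hl : ¬ (lam.re = 0 ∧ 0 ≤ lam.im)) :
    ∃ v : ℂ, 0 < v.im ∧ 0 < (lam * v).re := by
  by_cases h0 : lam.re = 0
  · have him : lam.im < 0 := not_le.1 fun h => hl ⟨h0, h⟩
    exact ⟨I, by simp, by simpa using him⟩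
  · refine ⟨⟨(lam.im + 1) / lam.re, 1⟩, one_pos, ?_⟩
    rw [mul_re, mul_div_cancel₀ _ h0]
    simp

theorem exists_shifted_sector_subset {Ω : Set ℂ} (hinner : innerArg Ω = Real.pi) {t : ℝ}
    (ht0 : 0 ≤ t) (ht : t < Real.pi) :
    ∃ θ : ℝ, t < θ ∧ θ ≤ Real.pi ∧ ∃ q : ℂ, (fun w => q + w) '' sector 0 θ ⊆ Ω := by
  rw [← hinner, innerArg] at ht
  obtain ⟨θ, hθ, hlt⟩ := exists_lt_of_lt_csSup ((singleton_nonempty 0).mono subset_union_left) ht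
  rcases hθ with rfl | ⟨hθ, hq⟩
  · exact absurd hlt ht0.not_gt
  · exact ⟨θ, hlt, hθ.2, hq⟩

theorem coe_nnnorm_exp_rpow (w : ℂ) (p : ℝ) :
    ((‖Complex.exp w‖₊ : ℝ≥0∞)) ^ p = ‖Complex.exp (p * w)‖ₑ := by
  rw [← enorm_eq_nnnorm, ← ofReal_norm, ← ofReal_norm, Complex.norm_exp, Complex.norm_exp,
    ENNReal.ofReal_rpow_of_pos (Real.exp_pos _), ← Real.exp_mul, re_ofReal_mul, mul_comm]

theorem not_memBergman_exp_of_sector_subset {Ω : Set ℂ} {h : ℂ → ℂ} (hK : IsKoenigsMap h Ω)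
    {p α : ℝ} (hp : 0 < p) {lam q v : ℂ} {θ : ℝ} (hθ : θ ≤ Real.pi) (hv : v ∈ sector 0 θ)
    (hq : (fun w => q + w) '' sector 0 θ ⊆ Ω) (hpos : 0 < (lam * v).re) :
    ¬ MemBergman p α (fun z => Complex.exp (lam * h z)) := by
  intro hmem
  obtain ⟨hd, hi, rfl⟩ := hK
  obtain ⟨g, hg, hgh⟩ := exists_differentiableOn_inverse isOpen_ball hd hi
  have hgmaps : MapsTo g (h '' ball 0 1) (ball 0 1) := by
    rintro _ ⟨z, hz, rfl⟩
    rwa [hgh z hz]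
  have hhg : ∀ w ∈ h '' ball 0 1, h (g w) = w := by
    rintro _ ⟨z, hz, rfl⟩
    rw [hgh z hz]
  simp only [MemBergman, coe_nnnorm_exp_rpow] at hmem
  obtain ⟨C, N, hC⟩ := exists_norm_mul_pow_le_of_lintegral_lt_top
    (((hd.const_mul lam).const_mul (p : ℂ)).cexp) hmem
  obtain ⟨δ, hδ, hball⟩ := Metric.isOpen_iff.1 (isOpen_sector hθ) v hv
  have hv0 : 0 < ‖v‖ := norm_pos_iff.2 hv.1
  obtain ⟨ρ, hρ⟩ : ∃ ρ : ℝ, ρ = 1 + δ / 2 / ‖v‖ := ⟨_, rfl⟩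
  have hρ1 : 1 < ρ := by rw [hρ]; linarith [show 0 < δ / 2 / ‖v‖ by positivity]
  let w : ℕ → ℂ := fun n => q + ((ρ ^ n : ℝ) : ℂ) * v
  have hwball : ∀ n, ball (w n) (ρ ^ n * δ) ⊆ h '' ball 0 1 := by
    intro n x hx
    have hρn : 0 < ρ ^ n := by positivity
    refine hq ⟨((ρ ^ n : ℝ) : ℂ) * (((ρ ^ n : ℝ) : ℂ)⁻¹ * (x - q)),
      real_mul_mem_sector hρn (hball ?_), ?_⟩
    · rw [mem_ball, dist_eq_norm] at hx ⊢
      have hne : ((ρ ^ n : ℝ) : ℂ) ≠ 0 := by exact_mod_cast hρn.ne'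
      have : ((ρ ^ n : ℝ) : ℂ)⁻¹ * (x - q) - v = ((ρ ^ n : ℝ) : ℂ)⁻¹ * (x - w n) := by
        simp only [w]
        field_simp
        ring
      rw [this, norm_mul, norm_inv, norm_real, Real.norm_of_nonneg hρn.le, inv_mul_lt_iff₀ hρn]
      exact hx
    · have hne : ((ρ ^ n : ℝ) : ℂ) ≠ 0 := by exact_mod_cast hρn.ne'
      simp only
      rw [mul_inv_cancel_left₀ hne]
      ring
  have hw : ∀ n, w n ∈ h '' ball 0 1 := fun n => hwball n (mem_ball_self (by positivity))
  have step : ∀ n, (1 - ‖g (w n)‖ ^ 2) * (3 / 16) ≤ 1 - ‖g (w (n + 1))‖ ^ 2 := by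
    intro n
    have hdist : dist (w (n + 1)) (w n) = ρ ^ n * δ / 2 := by
      have : w (n + 1) - w n = ((ρ ^ n * (δ / 2 / ‖v‖) : ℝ) : ℂ) * v := by
        simp only [w, pow_succ]
        rw [show δ / 2 / ‖v‖ = ρ - 1 by rw [hρ]; ring]
        push_cast
        ring
      rw [dist_eq_norm, this, norm_mul, norm_real, Real.norm_of_nonneg (by positivity)]
      field_simp
    refine one_sub_norm_sq_le_of_mapsTo_ball (hg.mono (hwball n))
      (hgmaps.mono_left (hwball n)) ?_ hdist.le
    rw [mem_ball, hdist]
    exact half_lt_self (by positivity)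
  obtain ⟨d, hdd⟩ : ∃ d, d = 1 - ‖g (w 0)‖ ^ 2 := ⟨_, rfl⟩
  have hd0 : 0 < d := by
    have := hgmaps (hw 0)
    rw [mem_ball_zero_iff] at this
    nlinarith [norm_nonneg (g (w 0))]
  have low : ∀ n : ℕ, d * (3 / 16) ^ n ≤ 1 - ‖g (w n)‖ ^ 2 := by
    intro n
    induction n with
    | zero => simp [hdd]
    | succ n ih => rw [pow_succ]; linarith [step n]
  have bound : ∀ n : ℕ, Real.exp (p * (lam * q).re + p * (lam * v).re * ρ ^ n) *
      (d * (3 / 16) ^ n) ^ N ≤ C := by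
    intro n
    refine le_trans ?_ (hC _ (hgmaps (hw n)))
    rw [hhg _ (hw n), Complex.norm_exp]
    refine mul_le_mul (le_of_eq ?_) (pow_le_pow_left₀ (by positivity) (low n) N) (by positivity)
      (by positivity)
    rw [re_ofReal_mul, show lam * w n = lam * q + ((ρ ^ n : ℝ) : ℂ) * (lam * v) by
      simp only [w]; ring, add_re, re_ofReal_mul]
    ring_nf
  have hC0 : 0 < C := lt_of_lt_of_le (by positivity) (bound 0)
  obtain ⟨n, hn⟩ := exists_linear_lt_exponential
    (p * (lam * q).re + N * Real.log d - Real.log C) (-(N * Real.log (3 / 16)))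
    (mul_pos hp hpos) hρ1
  have h1 := Real.log_le_log (by positivity) (bound n)
  rw [Real.log_mul (Real.exp_ne_zero _) (by positivity), Real.log_exp, Real.log_pow,
    Real.log_mul hd0.ne' (by positivity), Real.log_pow] at h1
  linarith

theorem memBergman_of_norm_le_one {p α : ℝ} (hp : 0 ≤ p) (hα : -1 < α) {f : ℂ → ℂ}
    (hf : ∀ z ∈ ball (0 : ℂ) 1, ‖f z‖ ≤ 1) : MemBergman p α f := by
  refine (setLIntegral_mono' measurableSet_ball fun z hz => ?_).trans_lt
    (lintegral_one_sub_norm_sq_rpow_lt_top hα)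
  refine mul_le_of_le_one_left' (ENNReal.rpow_le_one ?_ hp)
  exact_mod_cast hf z hz

/-- **Theorem 1.5(c), Bergman case.** For a parabolic semigroup of positive hyperbolic step with
Koenigs domain `Ω` in the upper half-plane and `θ_Ω = Θ_Ω = π` (e.g. a semigroup of finite
shift), the point spectrum on `A_α^p` is exactly `{it : t ≥ 0}`. -/
theorem bergman_spectrum_phs_args_pi
    (Ω : Set ℂ) (hopen : IsOpen Ω) (hsc : SimplyConnectedSpace ↥Ω)
    (hupper : Ω ⊆ {w : ℂ | 0 < w.im})
    (hconv : ConvexPosDir Ω)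
    (hnostrip : ∀ a b : ℝ, ¬ Ω ⊆ {w : ℂ | a < w.im ∧ w.im < b})
    (h : ℂ → ℂ) (hKoenigs : IsKoenigsMap h Ω)
    (p α : ℝ) (hp : 1 ≤ p) (hα : -1 < α)
    (hinner : innerArg Ω = Real.pi) (houter : outerArg Ω = Real.pi)
    (lam : ℂ) :
    MemBergman p α (fun z => Complex.exp (lam * h z)) ↔
      (lam.re = 0 ∧ 0 ≤ lam.im) := by
  constructor
  · intro hmem
    by_contra hl
    obtain ⟨v, hv, hpos⟩ := exists_mem_upperHalfPlane_re_mul_pos hl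
    have hv0 : v ≠ 0 := fun h0 => by simp [h0] at hv
    have harg0 : 0 < arg v := by
      refine lt_of_le_of_ne (arg_nonneg_iff.2 hv.le) fun h0 => ?_
      exact hv.ne' (arg_eq_zero_iff.1 h0.symm).2
    have harg1 : arg v < Real.pi :=
      lt_of_le_of_ne (arg_le_pi v) fun h1 => hv.ne' (arg_eq_pi_iff.1 h1).2
    obtain ⟨θ, hlt, hθ, q, hq⟩ := exists_shifted_sector_subset hinner harg0.le harg1
    exact not_memBergman_exp_of_sector_subset hKoenigs (by linarith) hθ ⟨hv0, harg0, hlt⟩ hq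
      hpos hmem
  · rintro ⟨hre, him⟩
    refine memBergman_of_norm_le_one (by linarith) hα fun z hz => ?_
    have hz' : 0 < (h z).im := hupper (hKoenigs.2.2 ▸ mem_image_of_mem h hz)
    rw [Complex.norm_exp, Real.exp_le_one_iff, mul_re, hre]
    nlinarith
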